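/- Let n ≥ 1, N ∈ ℕ, c > 0, let P_N ∈ ℝ^{(n+2(N+1))×(n+2(N+1))} and S, R ∈ ℝ^{2×2} be symmetric positive definite. For X ∈ ℝⁿ, u ∈ C¹([0,1], ℝ), v ∈ C⁰([0,1], ℝ), define χ(x) = [v(x) + c u'(x); v(1−x) − c u'(1−x)] ∈ ℝ², 𝔛_k = ∫₀¹ χ(x) ℒ_k(x) dx ∈ ℝ² for 0 ≤ k ≤ N, X_N = [X; 𝔛₀; …; 𝔛_N] ∈ ℝ^{n+2(N+1)}, and V_N(X, u, v) = X_Nᵀ P_N X_N + ∫₀¹ χ(x)ᵀ (S + x R) χ(x) dx. Then there exists ε₂ > 0, depending only on (P_N, S, R, c, n, N), such that V_N(X, u, v) ≤ ε₂ ‖(X,u,v)‖²_H for all such (X, u, v). -/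

import Mathlib

open Set Matrix

/-- The shifted Legendre polynomial on `[0,1]`:
`ℒ_k(x) = (−1)^k Σ_{l=0}^{k} (−1)^l (k choose l) ((k+l) choose l) x^l`. -/
noncomputable def shiftedLegendre (k : ℕ) (x : ℝ) : ℝ :=
  (-1 : ℝ)^k * ∑ l ∈ Finset.range (k+1),
    (-1 : ℝ)^l * (k.choose l : ℝ) * ((k+l).choose l : ℝ) * x^l

/-- The modified Riemann coordinate `χ(x) = [v(x)+c u'(x); v(1−x)−c u'(1−x)]`. -/
noncomputable def riemannChi (c : ℝ) (du v : ℝ → ℝ) (x : ℝ) : Fin 2 → ℝ :=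
  ![v x + c * du x, v (1-x) - c * du (1-x)]

/-- The Legendre projection `𝔛_k = ∫₀¹ χ(x) ℒ_k(x) dx ∈ ℝ²`. -/
noncomputable def legendreProj (c : ℝ) (du v : ℝ → ℝ) (k : ℕ) : Fin 2 → ℝ :=
  fun i => ∫ x in (0:ℝ)..1, riemannChi c du v x i * shiftedLegendre k x

/-- The augmented state `X_N = [X; 𝔛₀; …; 𝔛_N]`. -/
noncomputable def augmentedState (n N : ℕ) (c : ℝ) (X : Fin n → ℝ) (du v : ℝ → ℝ) :
    (Fin n ⊕ Fin (N+1) × Fin 2) → ℝ :=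
  Sum.elim X (fun p => legendreProj c du v (p.1 : ℕ) p.2)

/-- The Lyapunov functional `V_N(X,u,v) = X_Nᵀ P_N X_N + ∫₀¹ χᵀ(S+xR)χ dx`. -/
noncomputable def VN (n N : ℕ) (c : ℝ)
    (PN : Matrix (Fin n ⊕ Fin (N+1) × Fin 2) (Fin n ⊕ Fin (N+1) × Fin 2) ℝ)
    (S R : Matrix (Fin 2) (Fin 2) ℝ) (X : Fin n → ℝ) (du v : ℝ → ℝ) : ℝ :=
  augmentedState n N c X du v ⬝ᵥ PN.mulVec (augmentedState n N c X du v)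
    + ∫ x in (0:ℝ)..1, riemannChi c du v x ⬝ᵥ (S + x • R).mulVec (riemannChi c du v x)

/-- A real quadratic form is bounded above by a multiple of the sum of squares. -/
theorem exists_dotProduct_mulVec_le_sum_sq {ι : Type*} [Fintype ι] (M : Matrix ι ι ℝ) :
    ∃ C ≥ (0:ℝ), ∀ z : ι → ℝ, z ⬝ᵥ M.mulVec z ≤ C * ∑ i, (z i)^2 := by
  refine ⟨∑ i, ∑ j, |M i j|, by positivity, fun z => ?_⟩
  have hz (i : ι) : (z i)^2 ≤ ∑ k, (z k)^2 :=
    Finset.single_le_sum (f := fun k => (z k)^2) (fun k _ => sq_nonneg _) (Finset.mem_univ i)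
  simp_rw [dotProduct, mulVec, dotProduct, Finset.mul_sum Finset.univ (fun j => M _ j * z j),
    Finset.sum_mul]
  refine Finset.sum_le_sum fun i _ => Finset.sum_le_sum fun j _ => ?_
  have hprod : |z i * z j| ≤ ∑ k, (z k)^2 := by
    rw [abs_le]
    constructor <;> nlinarith [hz i, hz j, sq_nonneg (z i + z j), sq_nonneg (z i - z j)]
  calc z i * (M i j * z j) = M i j * (z i * z j) := by ring
    _ ≤ |M i j * (z i * z j)| := le_abs_self _
    _ = |M i j| * |z i * z j| := abs_mul _ _
    _ ≤ |M i j| * ∑ k, (z k)^2 := by gcongr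

/-- Jensen's inequality for the square on the unit interval. -/
theorem sq_intervalIntegral_le {f : ℝ → ℝ} (hf : ContinuousOn f (Icc (0:ℝ) 1)) :
    (∫ x in (0:ℝ)..1, f x)^2 ≤ ∫ x in (0:ℝ)..1, (f x)^2 := by
  set t := ∫ x in (0:ℝ)..1, f x with ht
  have hfi : IntervalIntegrable f MeasureTheory.volume 0 1 :=
    hf.intervalIntegrable_of_Icc zero_le_one
  have hfi2 : IntervalIntegrable (fun x => (f x)^2) MeasureTheory.volume 0 1 :=
    (hf.pow 2).intervalIntegrable_of_Icc zero_le_one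
  have hmono : ∫ x in (0:ℝ)..1, (2 * t * f x - t^2) ≤ ∫ x in (0:ℝ)..1, (f x)^2 :=
    intervalIntegral.integral_mono_on zero_le_one
      ((hfi.const_mul _).sub intervalIntegrable_const) hfi2
      fun x _ => by nlinarith [sq_nonneg (f x - t)]
  rw [intervalIntegral.integral_sub (hfi.const_mul _) intervalIntegrable_const,
    intervalIntegral.integral_const_mul, ← ht] at hmono
  simp only [intervalIntegral.integral_const, sub_zero, one_smul] at hmono
  linarith

theorem continuous_shiftedLegendre (k : ℕ) : Continuous (shiftedLegendre k) := by
  unfold shiftedLegendre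
  fun_prop

/-- The squared moment of a continuous function against `ℒ_k` is controlled by its `L²` norm. -/
theorem exists_sq_integral_mul_shiftedLegendre_le (k : ℕ) :
    ∃ B ≥ (0:ℝ), ∀ f : ℝ → ℝ, ContinuousOn f (Icc (0:ℝ) 1) →
      (∫ x in (0:ℝ)..1, f x * shiftedLegendre k x)^2 ≤ B * ∫ x in (0:ℝ)..1, (f x)^2 := by
  have hL := (continuous_shiftedLegendre k).continuousOn (s := Icc (0:ℝ) 1)
  obtain ⟨b, hb⟩ := isCompact_Icc.exists_bound_of_continuousOn hL
  refine ⟨b^2, sq_nonneg b, fun f hf => (sq_intervalIntegral_le (hf.mul hL)).trans ?_⟩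
  rw [← intervalIntegral.integral_const_mul]
  refine intervalIntegral.integral_mono_on zero_le_one
    (((hf.mul hL).pow 2).intervalIntegrable_of_Icc zero_le_one)
    (((hf.pow 2).const_smul (b^2)).intervalIntegrable_of_Icc zero_le_one) fun x hx => ?_
  have h : (shiftedLegendre k x)^2 ≤ b^2 :=
    sq_le_sq' (abs_le.mp (hb x hx)).1 (abs_le.mp (hb x hx)).2
  calc (f x * shiftedLegendre k x)^2 = (shiftedLegendre k x)^2 * (f x)^2 := by ring
    _ ≤ b^2 * (f x)^2 := by gcongr

theorem continuousOn_riemannChi {c : ℝ} {du v : ℝ → ℝ} (hdu : ContinuousOn du (Icc (0:ℝ) 1))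
    (hv : ContinuousOn v (Icc (0:ℝ) 1)) (i : Fin 2) :
    ContinuousOn (fun x => riemannChi c du v x i) (Icc (0:ℝ) 1) := by
  have hmaps : MapsTo (fun x : ℝ => 1 - x) (Icc (0:ℝ) 1) (Icc (0:ℝ) 1) :=
    fun x hx => ⟨by linarith [hx.2], by linarith [hx.1]⟩
  have hrefl : ContinuousOn (fun x : ℝ => 1 - x) (Icc (0:ℝ) 1) := by fun_prop
  fin_cases i
  · exact hv.add (continuousOn_const.mul hdu)
  · exact (hv.comp hrefl hmaps).sub (continuousOn_const.mul (hdu.comp hrefl hmaps))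

/-- The parallelogram identity for the `L²` norms of the Riemann coordinates. -/
theorem sum_integral_sq_riemannChi {c : ℝ} {du v : ℝ → ℝ} (hdu : ContinuousOn du (Icc (0:ℝ) 1))
    (hv : ContinuousOn v (Icc (0:ℝ) 1)) :
    ∑ i, ∫ x in (0:ℝ)..1, (riemannChi c du v x i)^2 =
      2 * (c^2 * (∫ x in (0:ℝ)..1, (du x)^2) + ∫ x in (0:ℝ)..1, (v x)^2) := by
  have hadd : ContinuousOn (fun x => (v x + c * du x)^2) (Icc (0:ℝ) 1) := by fun_prop
  have hsub : ContinuousOn (fun x => (v x - c * du x)^2) (Icc (0:ℝ) 1) := by fun_prop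
  have hdu2 : ContinuousOn (fun x => c^2 * (du x)^2) (Icc (0:ℝ) 1) := by fun_prop
  have hv2 : ContinuousOn (fun x => (v x)^2) (Icc (0:ℝ) 1) := by fun_prop
  have hrefl : ∫ x in (0:ℝ)..1, (v (1 - x) - c * du (1 - x))^2 =
      ∫ x in (0:ℝ)..1, (v x - c * du x)^2 := by
    simpa using intervalIntegral.integral_comp_sub_left (a := 0) (b := 1)
      (fun x => (v x - c * du x)^2) 1
  simp only [riemannChi, Fin.sum_univ_two, cons_val_zero, cons_val_one]
  rw [hrefl, ← intervalIntegral.integral_add (hadd.intervalIntegrable_of_Icc zero_le_one)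
      (hsub.intervalIntegrable_of_Icc zero_le_one),
    ← intervalIntegral.integral_const_mul, ← intervalIntegral.integral_add
      (hdu2.intervalIntegrable_of_Icc zero_le_one) (hv2.intervalIntegrable_of_Icc zero_le_one),
    ← intervalIntegral.integral_const_mul]
  exact intervalIntegral.integral_congr fun x _ => by ring

/-- The weighted `L²` term of `V_N` is controlled by the `L²` norm of the Riemann coordinates. -/
theorem exists_integral_riemannChi_quadratic_le (S R : Matrix (Fin 2) (Fin 2) ℝ) :
    ∃ C ≥ (0:ℝ), ∀ (c : ℝ) (du v : ℝ → ℝ), ContinuousOn du (Icc (0:ℝ) 1) →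
      ContinuousOn v (Icc (0:ℝ) 1) →
      ∫ x in (0:ℝ)..1, riemannChi c du v x ⬝ᵥ (S + x • R).mulVec (riemannChi c du v x) ≤
        C * ∑ i, ∫ x in (0:ℝ)..1, (riemannChi c du v x i)^2 := by
  obtain ⟨CS, hCS, hS⟩ := exists_dotProduct_mulVec_le_sum_sq S
  obtain ⟨CR, hCR, hR⟩ := exists_dotProduct_mulVec_le_sum_sq R
  refine ⟨CS + CR, add_nonneg hCS hCR, fun c du v hdu hv => ?_⟩
  have hχ := continuousOn_riemannChi (c := c) hdu hv
  have hχ2 (i : Fin 2) : ContinuousOn (fun x => (riemannChi c du v x i)^2) (Icc (0:ℝ) 1) :=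
    (hχ i).pow 2
  have hsq : ContinuousOn (fun x => ∑ i, (riemannChi c du v x i)^2) (Icc (0:ℝ) 1) :=
    continuousOn_finsetSum _ fun i _ => hχ2 i
  have hquad : ContinuousOn
      (fun x => riemannChi c du v x ⬝ᵥ (S + x • R).mulVec (riemannChi c du v x))
      (Icc (0:ℝ) 1) := by
    simp only [dotProduct, mulVec, Matrix.add_apply, Matrix.smul_apply, smul_eq_mul]
    fun_prop
  rw [← intervalIntegral.integral_finsetSum
      fun i _ => (hχ2 i).intervalIntegrable_of_Icc zero_le_one,
    ← intervalIntegral.integral_const_mul]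
  refine intervalIntegral.integral_mono_on zero_le_one
    (hquad.intervalIntegrable_of_Icc zero_le_one)
    ((continuousOn_const.mul hsq).intervalIntegrable_of_Icc zero_le_one) fun x hx => ?_
  have hsum : 0 ≤ ∑ i, (riemannChi c du v x i)^2 := by positivity
  rw [add_mulVec, smul_mulVec, dotProduct_add, dotProduct_smul, smul_eq_mul, add_mul]
  refine add_le_add (hS _) ((mul_le_mul_of_nonneg_left (hR _) hx.1).trans ?_)
  exact mul_le_of_le_one_left (mul_nonneg hCR hsum) hx.2

/-- The Legendre projections are jointly controlled by the `L²` norm of the Riemann coordinates. -/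
theorem exists_sum_sq_augmentedState_le (n N : ℕ) :
    ∃ B ≥ (0:ℝ), ∀ (c : ℝ) (X : Fin n → ℝ) (du v : ℝ → ℝ), ContinuousOn du (Icc (0:ℝ) 1) →
      ContinuousOn v (Icc (0:ℝ) 1) →
      ∑ p, (augmentedState n N c X du v p)^2 ≤
        ∑ i, (X i)^2 + B * ∑ i, ∫ x in (0:ℝ)..1, (riemannChi c du v x i)^2 := by
  choose B hB hle using exists_sq_integral_mul_shiftedLegendre_le
  refine ⟨∑ k : Fin (N+1), B k, Finset.sum_nonneg fun k _ => hB k, fun c X du v hdu hv => ?_⟩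
  rw [Fintype.sum_sum_type, Fintype.sum_prod_type, Finset.sum_mul_sum]
  exact add_le_add le_rfl (Finset.sum_le_sum fun k _ => Finset.sum_le_sum fun i _ =>
    hle k _ (continuousOn_riemannChi hdu hv i))

/-- Upper bound of the Lyapunov functional `V_N` by the `H`-norm: there exists
`ε₂ > 0` with `V_N(X,u,v) ≤ ε₂‖(X,u,v)‖²_H` for all `X ∈ ℝⁿ`, `u ∈ C¹`, `v ∈ C⁰`. -/
theorem lyapunov_VN_upper_bound
    (n : ℕ) (hn : 1 ≤ n) (N : ℕ) (c : ℝ) (hc : 0 < c)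
    (PN : Matrix (Fin n ⊕ Fin (N+1) × Fin 2) (Fin n ⊕ Fin (N+1) × Fin 2) ℝ)
    (S R : Matrix (Fin 2) (Fin 2) ℝ)
    (hP : PN.PosDef) (hS : S.PosDef) (hR : R.PosDef) :
    ∃ ε₂ > (0:ℝ),
      ∀ (X : Fin n → ℝ) (u du v : ℝ → ℝ),
        (∀ x ∈ Icc (0:ℝ) 1, HasDerivWithinAt u (du x) (Icc (0:ℝ) 1) x) →
        ContinuousOn du (Icc (0:ℝ) 1) →
        ContinuousOn v (Icc (0:ℝ) 1) →
        VN n N c PN S R X du v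
          ≤ ε₂ * ((∑ i, (X i)^2) + (∫ x in (0:ℝ)..1, (u x)^2)
              + c^2 * (∫ x in (0:ℝ)..1, (du x)^2) + ∫ x in (0:ℝ)..1, (v x)^2) := by
  obtain ⟨CP, hCP, hPle⟩ := exists_dotProduct_mulVec_le_sum_sq PN
  obtain ⟨C, hC, hSR⟩ := exists_integral_riemannChi_quadratic_le S R
  obtain ⟨B, hB, hstate⟩ := exists_sum_sq_augmentedState_le n N
  refine ⟨CP + 2 * (CP * B) + 2 * C + 1, by positivity, fun X u du v _ hdu hv => ?_⟩
  have hquad := (hPle _).trans (mul_le_mul_of_nonneg_left (hstate c X du v hdu hv) hCP)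
  have hint := hSR c du v hdu hv
  rw [sum_integral_sq_riemannChi hdu hv] at hquad hint
  have hsq_int (f : ℝ → ℝ) : 0 ≤ ∫ x in (0:ℝ)..1, (f x)^2 :=
    intervalIntegral.integral_nonneg zero_le_one fun x _ => sq_nonneg _
  have hX : 0 ≤ ∑ i, (X i)^2 := by positivity
  have hu := hsq_int u
  have hW : 0 ≤ c^2 * (∫ x in (0:ℝ)..1, (du x)^2) + ∫ x in (0:ℝ)..1, (v x)^2 :=
    add_nonneg (mul_nonneg (sq_nonneg c) (hsq_int du)) (hsq_int v)
  have hCPB := mul_nonneg hCP hB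
  unfold VN
  set W := c^2 * (∫ x in (0:ℝ)..1, (du x)^2) + ∫ x in (0:ℝ)..1, (v x)^2
  set U := ∫ x in (0:ℝ)..1, (u x)^2
  rw [add_assoc (∑ i, (X i)^2 + U)]
  nlinarith [mul_nonneg hCP hu, mul_nonneg hCP hW, mul_nonneg hCPB hX, mul_nonneg hCPB hu,
    mul_nonneg hC hX, mul_nonneg hC hu]
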